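/- Let p>1, let a∈C^1([0,1]) with a(x)>0 on [0,1], let C_0>0 be the constant from (W1), and let [s,t]⊂[0,1] with s<t. For ε>0 let l_ε(s,t) denote the number of zeros in (s,t) of the solution of the initial value problem ε(φ_p(εu'))' + C_0 a(x)φ_p(u) = 0, u(s)=0, u'(s)=1 (this number equals the number of negative eigenvalues of the Dirichlet problem -ε(φ_p(εu'))' - C_0 a(x)φ_p(u) = λφ_p(u), u(s)=u(t)=0). Then lim_{ε→0^+} ε l_ε(s,t) = (C_0^{1/p}/π_p) ∫_s^t a(x)^{1/p} dx. -/

import Mathlib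

open Real Set Filter Topology MeasureTheory intervalIntegral Asymptotics

noncomputable section

/-- `φ_p(s) = |s|^{p-2} s`. -/
def phip (p s : ℝ) : ℝ := |s| ^ (p - 2) * s

/-- `L(s) = |s|^p / p*` with `p* = p/(p-1)`. -/
def Lfun (p s : ℝ) : ℝ := |s| ^ p / (p / (p - 1))

/-- condition (W1) -/
def W1cond (p : ℝ) (W : ℝ → ℝ) (Cm1 C0 C1 W0 : ℝ) : Prop :=
  0 < Cm1 ∧ 0 < C0 ∧ 0 < C1 ∧ 0 < W0 ∧
  (fun u => W u - C1 / p * |u - 1| ^ p) =o[𝓝[Set.Icc (-1:ℝ) 1] 1] (fun u => |u - 1| ^ p) ∧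
  (fun u => W u - Cm1 / p * |u + 1| ^ p) =o[𝓝[Set.Icc (-1:ℝ) 1] (-1)] (fun u => |u + 1| ^ p) ∧
  (fun u => W u - (W0 - C0 / p * |u| ^ p)) =o[𝓝[Set.Icc (-1:ℝ) 1] 0] (fun u => |u| ^ p)

/-- condition (W2) -/
def W2cond (p : ℝ) (W : ℝ → ℝ) : Prop :=
  StrictAntiOn (fun u => deriv W u / phip p u) (Set.Ico (-1:ℝ) 0) ∧
  StrictMonoOn (fun u => deriv W u / phip p u) (Set.Ioc (0:ℝ) 1)

/-- `v` (with derivative `v'`) is a global solution of `-(φ_p(v'))' + a W'(v) = 0`. -/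
def IsSolAuto (p aa : ℝ) (W v v' : ℝ → ℝ) : Prop :=
  Continuous v' ∧ (∀ x, HasDerivAt v (v' x) x) ∧
  ∃ g : ℝ → ℝ, Continuous g ∧ (∀ x, HasDerivAt (fun y => phip p (v' y)) (g x) x) ∧
    ∀ x, g x = aa * deriv W (v x)

/-- `v` (with derivative `v'`) solves `-(φ_p(v'))' + a W'(v) = 0` on the open set `I`. -/
def IsSolAutoOn (p aa : ℝ) (W v v' : ℝ → ℝ) (I : Set ℝ) : Prop :=
  ContinuousOn v' I ∧ (∀ x ∈ I, HasDerivAt v (v' x) x) ∧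
  ∃ g : ℝ → ℝ, ContinuousOn g I ∧ (∀ x ∈ I, HasDerivAt (fun y => phip p (v' y)) (g x) x) ∧
    ∀ x ∈ I, g x = aa * deriv W (v x)

/-- `u` (with derivative `u'`) solves `-ε(φ_p(εu'))' + a(x) W'(u) = 0` on `S`. -/
def IsSolOn (p ε : ℝ) (a W u u' : ℝ → ℝ) (S : Set ℝ) : Prop :=
  ContinuousOn u' S ∧ (∀ x ∈ S, HasDerivWithinAt u (u' x) S x) ∧
  ∃ g : ℝ → ℝ, ContinuousOn g S ∧
    (∀ x ∈ S, HasDerivWithinAt (fun y => phip p (ε * u' y)) (g x) S x) ∧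
    ∀ x ∈ S, ε * g x = a x * deriv W (u x)

/-- `u` is a solution of the Neumann problem `(P_ε)`. -/
def IsNeumann (p ε : ℝ) (a W u u' : ℝ → ℝ) : Prop :=
  IsSolOn p ε a W u u' (Set.Icc 0 1) ∧ u' 0 = 0 ∧ u' 1 = 0

/-- energy of a solution of `(P_ε)` -/
def Ener (p ε : ℝ) (a W u u' : ℝ → ℝ) (x : ℝ) : ℝ :=
  -(1 / a x) * Lfun p (ε * u' x) + W (u x)

/-- `π_p` -/
def pip (p : ℝ) : ℝ := 2 * (p - 1) ^ (1 / p) * ∫ s in (0:ℝ)..1, ((1:ℝ) - s ^ p) ^ (-(1 / p))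

/-- `u` (with derivative `u'`) solves `ε(φ_p(εu'))' + C₀ a(x) φ_p(u) = 0` on `[s,t]`. -/
def IsEigenSol (p ε C0 : ℝ) (a u u' : ℝ → ℝ) (s t : ℝ) : Prop :=
  ContinuousOn u' (Set.Icc s t) ∧
  (∀ x ∈ Set.Icc s t, HasDerivWithinAt u (u' x) (Set.Icc s t) x) ∧
  ∃ g : ℝ → ℝ, ContinuousOn g (Set.Icc s t) ∧
    (∀ x ∈ Set.Icc s t,
      HasDerivWithinAt (fun y => phip p (ε * u' y)) (g x) (Set.Icc s t) x) ∧
    ∀ x ∈ Set.Icc s t, ε * g x + C0 * a x * phip p (u x) = 0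

/-- The primitive `∫_0^ρ dr / (1 + (p-1)|r|^{p*})` of the Riccati vector field. -/
def arcp (p ρ : ℝ) : ℝ := ∫ r in (0:ℝ)..ρ, (1 + (p - 1) * |r| ^ (p / (p - 1)))⁻¹

lemma one_add_mul_abs_rpow_pos {p : ℝ} (hp : 1 < p) (r : ℝ) :
    0 < 1 + (p - 1) * |r| ^ (p / (p - 1)) := by
  have h1 : 0 ≤ |r| ^ (p / (p - 1)) := by positivity
  have h2 : 0 < p - 1 := by linarith
  positivity

lemma arcp_integrand_continuous {p : ℝ} (hp : 1 < p) :
    Continuous fun r : ℝ => (1 + (p - 1) * |r| ^ (p / (p - 1)))⁻¹ := by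
  have h2 : 0 < p - 1 := by linarith
  refine Continuous.inv₀ ?_ fun r => (one_add_mul_abs_rpow_pos hp r).ne'
  have : Continuous fun r : ℝ => |r| ^ (p / (p - 1)) :=
    continuous_abs.rpow_const fun _ => Or.inr (by positivity)
  fun_prop

lemma arcp_hasDerivAt {p : ℝ} (hp : 1 < p) (ρ : ℝ) :
    HasDerivAt (arcp p) (1 + (p - 1) * |ρ| ^ (p / (p - 1)))⁻¹ ρ :=
  integral_hasDerivAt_right ((arcp_integrand_continuous hp).intervalIntegrable _ _)
    ((arcp_integrand_continuous hp).stronglyMeasurableAtFilter _ _)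
    (arcp_integrand_continuous hp).continuousAt

lemma arcp_continuous {p : ℝ} (hp : 1 < p) : Continuous (arcp p) :=
  continuous_iff_continuousAt.2 fun ρ => (arcp_hasDerivAt hp ρ).continuousAt

lemma arcp_zero (p : ℝ) : arcp p 0 = 0 := by simp [arcp]

lemma arcp_neg (p ρ : ℝ) : arcp p (-ρ) = -arcp p ρ := by
  have h := intervalIntegral.integral_comp_neg (a := 0) (b := ρ)
    (fun r : ℝ => (1 + (p - 1) * |r| ^ (p / (p - 1)))⁻¹)
  simp only [abs_neg, neg_zero] at h
  rw [arcp, arcp, h, integral_symm]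

lemma arcp_monotone {p : ℝ} (hp : 1 < p) : Monotone (arcp p) :=
  monotone_of_hasDerivAt_nonneg (arcp_hasDerivAt hp)
    fun ρ => (inv_pos.2 (one_add_mul_abs_rpow_pos hp ρ)).le

lemma intervalIntegrable_one_sub_rpow {p : ℝ} (hp : 1 < p) :
    IntervalIntegrable (fun s : ℝ => ((1:ℝ) - s ^ p) ^ (-(1 / p))) volume 0 1 := by
  have h1 : 1 / p < 1 := by rw [div_lt_one (by linarith)]; exact hp
  have hbase : IntervalIntegrable (fun s : ℝ => (1 - s) ^ (-(1 / p))) volume 0 1 := by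
    have h := (intervalIntegrable_rpow' (a := 0) (b := 1) (r := -(1 / p))
      (by linarith)).comp_sub_left 1
    simpa using h.symm
  refine hbase.mono_fun ?_ ?_
  · exact (by fun_prop : Measurable fun s : ℝ => ((1:ℝ) - s ^ p) ^ (-(1 / p))).aestronglyMeasurable
  · rw [uIoc_of_le zero_le_one]
    have hne : ∀ᵐ s : ℝ ∂(volume.restrict (Ioc (0:ℝ) 1)), s ≠ 1 :=
      ae_restrict_of_ae (by simp [ae_iff])
    filter_upwards [hne, ae_restrict_mem measurableSet_Ioc] with s hs1 hs
    have hlt : s < 1 := lt_of_le_of_ne hs.2 hs1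
    have hsp : s ^ p ≤ s := by
      simpa using rpow_le_rpow_of_exponent_ge hs.1 hs.2 hp.le
    have h3 : 0 < 1 - s := by linarith
    have h4 : 0 < 1 - s ^ p := by linarith
    rw [norm_of_nonneg (by positivity), norm_of_nonneg (by positivity)]
    exact rpow_le_rpow_of_nonpos h3 (by linarith) (by
      have : 0 < 1 / p := by positivity
      linarith)

lemma pip_pos {p : ℝ} (hp : 1 < p) : 0 < pip p := by
  have h2 : 0 < p - 1 := by linarith
  have : 0 < ∫ s in (0:ℝ)..1, ((1:ℝ) - s ^ p) ^ (-(1 / p)) := by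
    refine intervalIntegral_pos_of_pos_on (intervalIntegrable_one_sub_rpow hp) ?_ zero_lt_one
    intro s hs
    have : s ^ p < 1 := rpow_lt_one hs.1.le hs.2 (by linarith)
    have : 0 < 1 - s ^ p := by linarith
    positivity
  rw [pip]
  positivity

/-- The incomplete version of `π_p / 2`, as a function of the upper limit. -/
def pipPartial (p x : ℝ) : ℝ :=
  (p - 1) ^ (1 / p) * ∫ s in (0:ℝ)..x, ((1:ℝ) - s ^ p) ^ (-(1 / p))

lemma pipPartial_continuousOn {p : ℝ} (hp : 1 < p) :
    ContinuousOn (pipPartial p) (Icc 0 1) := by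
  have h := continuousOn_primitive_interval
    ((intervalIntegrable_iff' (μ := volume)).1 (intervalIntegrable_one_sub_rpow hp))
  rw [uIcc_of_le zero_le_one] at h
  exact continuousOn_const.mul h

lemma pipPartial_hasDerivAt {p x : ℝ} (hp : 1 < p) (hx : x ∈ Ioo (0:ℝ) 1) :
    HasDerivAt (pipPartial p) ((p - 1) ^ (1 / p) * (1 - x ^ p) ^ (-(1 / p))) x := by
  refine HasDerivAt.const_mul _ ?_
  have hx1 : x ^ p < 1 := rpow_lt_one hx.1.le hx.2 (by linarith)
  refine integral_hasDerivAt_right ?_ ?_ ?_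
  · refine (intervalIntegrable_one_sub_rpow hp).mono_set ?_
    rw [uIcc_of_le hx.1.le, uIcc_of_le zero_le_one]
    exact Icc_subset_Icc_right hx.2.le
  · exact (by fun_prop : Measurable fun s : ℝ =>
      ((1:ℝ) - s ^ p) ^ (-(1 / p))).stronglyMeasurable.stronglyMeasurableAtFilter
  · refine ContinuousAt.rpow_const ?_ (Or.inl (by linarith))
    exact continuousAt_const.sub (continuousAt_id.rpow_const (Or.inl hx.1.ne'))

lemma arcp_substitution_hasDerivAt {p ρ : ℝ} (hp : 1 < p) (hρ : 0 < ρ) :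
    HasDerivAt (fun r => pipPartial p ((1 + (p - 1) * |r| ^ (p / (p - 1))) ^ (-(1 / p))))
      (-(1 + (p - 1) * |ρ| ^ (p / (p - 1)))⁻¹) ρ := by
  have h2 : 0 < p - 1 := by linarith
  have hp0 : 0 < p := by linarith
  set q := p / (p - 1) with hq
  have hq1 : 1 < q := by rw [hq, lt_div_iff₀ h2]; linarith
  have hρq : 0 < ρ ^ q := by positivity
  have hD : 1 < 1 + (p - 1) * |ρ| ^ q := by rw [abs_of_pos hρ]; nlinarith [mul_pos h2 hρq]
  have hin : HasDerivAt (fun r : ℝ => (1 + (p - 1) * |r| ^ q) ^ (-(1 / p)))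
      ((p - 1) * (q * |ρ| ^ (q - 2) * ρ) * (-(1 / p)) *
        (1 + (p - 1) * |ρ| ^ q) ^ (-(1 / p) - 1)) ρ :=
    (((hasDerivAt_abs_rpow ρ hq1).const_mul (p - 1)).const_add 1).rpow_const
      (Or.inl (by linarith))
  set D := 1 + (p - 1) * |ρ| ^ q with hDdef
  have hD0 : 0 < D := by linarith
  have hx : D ^ (-(1 / p)) ∈ Ioo (0:ℝ) 1 :=
    ⟨by positivity, rpow_lt_one_of_one_lt_of_neg hD (by
      have : 0 < 1 / p := by positivity
      linarith)⟩
  refine ((pipPartial_hasDerivAt hp hx).comp ρ hin).congr_deriv ?_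
  have e1 : (D ^ (-(1 / p))) ^ p = D⁻¹ := by
    rw [← rpow_mul hD0.le, ← rpow_neg_one]; congr 1; field_simp
  have e2 : 1 - D⁻¹ = (p - 1) * ρ ^ q * D⁻¹ := by
    rw [hDdef, abs_of_pos hρ] at *; field_simp; ring
  have e3 : (ρ ^ q) ^ (-(1 / p)) = ρ ^ (1 - q) := by
    rw [← rpow_mul hρ.le]; congr 1; rw [hq]; field_simp; ring
  have e4 : (D⁻¹) ^ (-(1 / p)) = D ^ (1 / p) := by
    rw [inv_rpow hD0.le, rpow_neg hD0.le, inv_inv]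
  have e5 : ρ ^ (q - 2) * ρ = ρ ^ (q - 1) := by
    rw [← rpow_add_one hρ.ne']; congr 1; ring
  have e6 : ρ ^ (1 - q) * ρ ^ (q - 1) = 1 := by
    rw [← rpow_add hρ]; simp
  have e7 : (p - 1) ^ (1 / p) * (p - 1) ^ (-(1 / p)) = 1 := by
    rw [← rpow_add h2]; simp
  have e8 : D ^ (1 / p) * D ^ (-(1 / p) - 1) = D⁻¹ := by
    rw [← rpow_add hD0, ← rpow_neg_one]; congr 1; ring
  have e9 : (p - 1) * q * (1 / p) = 1 := by rw [hq]; field_simp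
  rw [e1, e2, mul_rpow (by positivity) (by positivity), mul_rpow h2.le hρq.le, e3, e4,
    abs_of_pos hρ, mul_assoc q, e5]
  calc _ = -(((p - 1) ^ (1 / p) * (p - 1) ^ (-(1 / p))) * (ρ ^ (1 - q) * ρ ^ (q - 1)) *
        ((p - 1) * q * (1 / p)) * (D ^ (1 / p) * D ^ (-(1 / p) - 1))) := by ring
    _ = _ := by rw [e6, e7, e8, e9]; ring

lemma arcp_eq_sub_pipPartial {p ρ : ℝ} (hp : 1 < p) (hρ : 0 < ρ) :
    arcp p ρ = pip p / 2 - pipPartial p ((1 + (p - 1) * |ρ| ^ (p / (p - 1))) ^ (-(1 / p))) := by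
  have h2 : 0 < p - 1 := by linarith
  have hp0 : 0 < p := by linarith
  have hq0 : 0 < p / (p - 1) := by positivity
  set S : ℝ → ℝ := fun r => (1 + (p - 1) * |r| ^ (p / (p - 1))) ^ (-(1 / p)) with hS
  have hScont : Continuous S := by
    have h1 : Continuous fun r : ℝ => |r| ^ (p / (p - 1)) :=
      continuous_abs.rpow_const fun _ => Or.inr hq0.le
    exact (by fun_prop : Continuous fun r : ℝ => 1 + (p - 1) * |r| ^ (p / (p - 1))).rpow_const
      fun r => Or.inl (one_add_mul_abs_rpow_pos hp r).ne'
  have hSmem : ∀ r, S r ∈ Icc (0:ℝ) 1 := fun r => by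
    have h0 := one_add_mul_abs_rpow_pos hp r
    refine ⟨by positivity, rpow_le_one_of_one_le_of_nonpos ?_ ?_⟩
    · have : 0 ≤ (p - 1) * |r| ^ (p / (p - 1)) := by positivity
      linarith
    · have : 0 < 1 / p := by positivity
      linarith
  have hcont : ContinuousOn (fun r => arcp p r + pipPartial p (S r)) (Icc 0 ρ) :=
    ((arcp_continuous hp).add
      ((pipPartial_continuousOn hp).comp_continuous hScont hSmem)).continuousOn
  have hconst := constant_of_has_deriv_right_zero (f := fun r => arcp p (ρ - r) +
      pipPartial p (S (ρ - r))) (a := 0) (b := ρ)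
    (hcont.comp (by fun_prop) (fun r hr => ⟨by linarith [hr.2], by linarith [hr.1]⟩))
    (fun r hr => by
      have hpos : 0 < ρ - r := by linarith [hr.2]
      have h := ((arcp_hasDerivAt hp (ρ - r)).add
        (arcp_substitution_hasDerivAt hp hpos)).scomp r ((hasDerivAt_id r).const_sub ρ)
      refine (h.congr_deriv ?_).hasDerivWithinAt
      simp) ρ ⟨hρ.le, le_rfl⟩
  have hS0 : S 0 = 1 := by simp [hS, hq0.ne']
  have hP1 : pipPartial p 1 = pip p / 2 := by rw [pipPartial, pip]; ring
  simp only [sub_self, sub_zero, arcp_zero, hS0, hP1, zero_add] at hconst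
  linarith

lemma arcp_tendsto_atTop {p : ℝ} (hp : 1 < p) : Tendsto (arcp p) atTop (𝓝 (pip p / 2)) := by
  have h2 : 0 < p - 1 := by linarith
  have hp0 : 0 < p := by linarith
  have hq0 : 0 < p / (p - 1) := by positivity
  have h1 : Tendsto (fun r : ℝ => (1 + (p - 1) * |r| ^ (p / (p - 1))) ^ (-(1 / p)))
      atTop (𝓝[Icc 0 1] 0) := by
    refine tendsto_nhdsWithin_iff.2 ⟨?_, ?_⟩
    · refine (tendsto_rpow_neg_atTop (by positivity)).comp ?_
      exact tendsto_atTop_add_const_left _ _ (((tendsto_rpow_atTop hq0).comp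
        tendsto_abs_atTop_atTop).const_mul_atTop h2)
    · refine Eventually.of_forall fun r => ?_
      have h0 := one_add_mul_abs_rpow_pos hp r
      refine ⟨by positivity, rpow_le_one_of_one_le_of_nonpos ?_ ?_⟩
      · have : 0 ≤ (p - 1) * |r| ^ (p / (p - 1)) := by positivity
        linarith
      · have : 0 < 1 / p := by positivity
        linarith
  have h3 : Tendsto (pipPartial p) (𝓝[Icc 0 1] 0) (𝓝 0) := by
    have := pipPartial_continuousOn hp 0 ⟨le_rfl, zero_le_one⟩
    simpa [ContinuousWithinAt, pipPartial] using this
  have h4 := (h3.comp h1).const_sub (pip p / 2)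
  rw [sub_zero] at h4
  refine h4.congr' ?_
  filter_upwards [eventually_gt_atTop 0] with ρ hρ
  exact (arcp_eq_sub_pipPartial hp hρ).symm

lemma arcp_tendsto_atBot {p : ℝ} (hp : 1 < p) : Tendsto (arcp p) atBot (𝓝 (-(pip p / 2))) := by
  have h := ((arcp_tendsto_atTop hp).comp tendsto_neg_atBot_atTop).neg
  simpa [Function.comp_def, arcp_neg] using h

lemma abs_arcp_le {p : ℝ} (hp : 1 < p) (ρ : ℝ) : |arcp p ρ| ≤ pip p / 2 :=
  abs_le.2 ⟨(arcp_monotone hp).le_of_tendsto (arcp_tendsto_atBot hp) ρ,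
    (arcp_monotone hp).ge_of_tendsto (arcp_tendsto_atTop hp) ρ⟩

lemma phip_zero (p : ℝ) : phip p 0 = 0 := by simp [phip]

lemma phip_neg (p v : ℝ) : phip p (-v) = -phip p v := by simp [phip]

lemma phip_of_pos {p v : ℝ} (hv : 0 < v) : phip p v = v ^ (p - 1) := by
  rw [phip, abs_of_pos hv, ← rpow_add_one hv.ne']
  congr 1; ring

lemma abs_phip {p : ℝ} (hp : 1 < p) (v : ℝ) : |phip p v| = |v| ^ (p - 1) := by
  rcases eq_or_ne v 0 with rfl | hv
  · have : p - 1 ≠ 0 := by linarith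
    simp [phip_zero, zero_rpow this]
  · rw [phip, abs_mul, abs_of_nonneg (by positivity), ← rpow_add_one (abs_ne_zero.2 hv)]
    congr 1; ring

lemma phip_mul_self {p : ℝ} (hp : 1 < p) (v : ℝ) : phip p v * v = |v| ^ p := by
  rcases eq_or_ne v 0 with rfl | hv
  · simp [zero_rpow (by linarith : p ≠ 0)]
  · have h : v * v = |v| * |v| := (abs_mul_abs_self v).symm
    rw [phip, mul_assoc, h, ← mul_assoc, ← rpow_add_one (abs_ne_zero.2 hv),
      ← rpow_add_one (abs_ne_zero.2 hv)]
    congr 1; ring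

lemma abs_phip_rpow {p : ℝ} (hp : 1 < p) (v : ℝ) : |phip p v| ^ (p / (p - 1)) = |v| ^ p := by
  have h2 : p - 1 ≠ 0 := by linarith
  rw [abs_phip hp, ← rpow_mul (abs_nonneg v)]
  congr 1; field_simp

lemma phip_conjugate {p : ℝ} (hp : 1 < p) (v : ℝ) :
    |phip p v| ^ (p / (p - 1) - 2) * phip p v = v := by
  rcases eq_or_ne v 0 with rfl | hv
  · simp [phip_zero]
  · have h2 : p - 1 ≠ 0 := by linarith
    have hv' : 0 < |v| := abs_pos.2 hv
    rw [abs_phip hp, ← rpow_mul (abs_nonneg v), phip, ← mul_assoc, ← rpow_add hv']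
    have : (p - 1) * (p / (p - 1) - 2) + (p - 2) = 0 := by field_simp; ring
    rw [this, rpow_zero, one_mul]

lemma phip_pos {p v : ℝ} (hv : 0 < v) : 0 < phip p v := by
  rw [phip_of_pos hv]; positivity

lemma phip_continuous {p : ℝ} (hp : 1 < p) : Continuous (phip p) := by
  rw [continuous_iff_continuousAt]
  intro v
  rcases eq_or_ne v 0 with rfl | hv
  · rw [ContinuousAt, phip_zero, tendsto_zero_iff_abs_tendsto_zero]
    have h : Tendsto (fun v : ℝ => |v| ^ (p - 1)) (𝓝 0) (𝓝 (|0| ^ (p - 1))) :=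
      (continuous_abs.rpow_const fun _ => Or.inr (by linarith)).tendsto 0
    rw [abs_zero, zero_rpow (by linarith)] at h
    exact h.congr fun v => (abs_phip hp v).symm
  · exact (continuous_abs.continuousAt.rpow_const (Or.inl (abs_ne_zero.2 hv))).mul continuousAt_id

lemma IsEigenSol.neg {p ε C : ℝ} {a u u' : ℝ → ℝ} {s t : ℝ} (h : IsEigenSol p ε C a u u' s t) :
    IsEigenSol p ε C a (fun x => -u x) (fun x => -u' x) s t := by
  obtain ⟨h1, h2, g, h3, h4, h5⟩ := h
  refine ⟨h1.neg, fun x hx => (h2 x hx).neg, fun x => -g x, h3.neg, fun x hx => ?_, fun x hx => ?_⟩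
  · simp only [mul_neg, phip_neg]
    exact (h4 x hx).neg
  · have := h5 x hx
    rw [phip_neg]; linarith

lemma IsEigenSol.continuousOn {p ε C : ℝ} {a u u' : ℝ → ℝ} {s t : ℝ}
    (h : IsEigenSol p ε C a u u' s t) : ContinuousOn u (Icc s t) :=
  fun x hx => (h.2.1 x hx).continuousWithinAt

/-- A solution with `u(s) = 0`, `u'(s) = 1` has only simple zeros. -/
lemma IsEigenSol.deriv_ne_zero {p ε C M : ℝ} {a u u' : ℝ → ℝ} {s t : ℝ}
    (h : IsEigenSol p ε C a u u' s t) (hp : 1 < p) (hε : 0 < ε) (hC : 0 < C)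
    (haC : ContDiff ℝ 1 a) (hapos : ∀ x ∈ Icc s t, 0 < a x)
    (hM : ∀ x ∈ Icc s t, |deriv a x| ≤ M * a x) (hu's : u' s = 1)
    {x : ℝ} (hx : x ∈ Icc s t) (hux : u x = 0) : u' x ≠ 0 := by
  intro hu'x
  have h2 : 0 < p - 1 := by linarith
  have hq1 : 1 < p / (p - 1) := by rw [lt_div_iff₀ h2]; linarith
  obtain ⟨-, hu, g, -, hw, heq⟩ := h
  set E : ℝ → ℝ := fun y => (p - 1) * |phip p (ε * u' y)| ^ (p / (p - 1)) + C * a y * |u y| ^ p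
    with hE
  have hEd : ∀ y ∈ Icc s t, HasDerivWithinAt E (C * deriv a y * |u y| ^ p) (Icc s t) y := by
    intro y hy
    have d1 := (((hasDerivAt_abs_rpow (phip p (ε * u' y)) hq1).comp_hasDerivWithinAt y
      (hw y hy))).const_mul (p - 1)
    have d2 := (hasDerivAt_abs_rpow (u y) hp).comp_hasDerivWithinAt y (hu y hy)
    have d3 := ((haC.differentiable one_ne_zero y).hasDerivAt.hasDerivWithinAt
      (s := Icc s t)).const_mul C
    refine (d1.add (d3.mul d2)).congr_deriv ?_
    have e1 := phip_conjugate hp (ε * u' y)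
    have e2 := heq y hy
    have e3 : (p - 1) * (p / (p - 1)) = p := by field_simp
    simp only [Function.comp_apply]
    rw [mul_assoc (p / (p - 1)), e1]
    have e4 : ε * g y * u' y + C * a y * phip p (u y) * u' y = 0 := by
      rw [← add_mul, e2, zero_mul]
    rw [phip] at e4
    linear_combination p * e4 + (ε * u' y * g y) * e3
  have hmono : MonotoneOn (fun y => E y * exp (M * y)) (Icc s t) := by
    have hd : ∀ y ∈ Icc s t, HasDerivWithinAt (fun y => E y * exp (M * y))
        (C * deriv a y * |u y| ^ p * exp (M * y) + E y * (exp (M * y) * M)) (Icc s t) y := by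
      intro y hy
      have hexp : HasDerivAt (fun y => exp (M * y)) (exp (M * y) * M) y := by
        simpa using ((hasDerivAt_id y).const_mul M).exp
      exact (hEd y hy).mul hexp.hasDerivWithinAt
    refine monotoneOn_of_hasDerivWithinAt_nonneg (convex_Icc s t)
      (fun y hy => (hd y hy).continuousWithinAt)
      (fun y hy => (hd y (interior_subset hy)).mono interior_subset) ?_
    intro y hy
    have hy' := interior_subset hy
    have hMy := hM y hy'
    have hM0 : 0 ≤ M := by
      have := (abs_nonneg _).trans hMy
      exact nonneg_of_mul_nonneg_left this (hapos y hy')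
    have k1 : 0 ≤ deriv a y + M * a y := by linarith [neg_abs_le (deriv a y)]
    have k2 : 0 ≤ M * ((p - 1) * |phip p (ε * u' y)| ^ (p / (p - 1))) := by positivity
    have k3 : 0 ≤ C * |u y| ^ p * (deriv a y + M * a y) := by positivity
    have k4 : C * deriv a y * |u y| ^ p * exp (M * y) + E y * (exp (M * y) * M) =
      (M * ((p - 1) * |phip p (ε * u' y)| ^ (p / (p - 1))) +
        C * |u y| ^ p * (deriv a y + M * a y)) * exp (M * y) := by rw [hE]; ring
    rw [k4]; positivity
  have hst : s ≤ t := hx.1.trans hx.2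
  have hle := hmono (left_mem_Icc.2 hst) hx hx.1
  have hEx : E x = 0 := by
    have : p / (p - 1) ≠ 0 := by positivity
    simp [hE, hux, hu'x, phip_zero, this, (by linarith : p ≠ 0)]
  have hEs : 0 < E s := by
    have k1 : 0 < (p - 1) * |phip p (ε * u' s)| ^ (p / (p - 1)) := by
      rw [abs_phip_rpow hp, hu's, mul_one]; positivity
    have k2 : 0 ≤ C * a s * |u s| ^ p := by
      have := hapos s (left_mem_Icc.2 hst); positivity
    exact add_pos_of_pos_of_nonneg k1 k2
  simp only [hEx, zero_mul] at hle
  have : 0 < E s * exp (M * s) := by positivity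
  linarith

/-- Riccati equation for the normalized logarithmic derivative, in integrated form. -/
lemma arcp_riccati {p ε C M a' g d x : ℝ} {a u w : ℝ → ℝ} (hp : 1 < p) (hε : 0 < ε) (hC : 0 < C)
    (ha : HasDerivAt a a' x) (hax : 0 < a x) (hM : |a'| ≤ M * a x)
    (hu : HasDerivAt u d x) (hux : 0 < u x) (hw : HasDerivAt w g x)
    (hwx : w x = phip p (ε * d)) (heq : ε * g + C * a x * phip p (u x) = 0) :
    ∃ k, HasDerivAt (fun y => arcp p (w y / ((C * a y) ^ (1 / p) * u y) ^ (p - 1))) k x ∧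
      |k + (C * a x) ^ (1 / p) / ε| ≤ M := by
  have h2 : 0 < p - 1 := by linarith
  have hp0 : 0 < p := by linarith
  have hCa : 0 < C * a x := by positivity
  set b := (C * a x) ^ (1 / p) with hb
  have hb0 : 0 < b := by positivity
  have hbp : C * a x = b ^ p := by
    rw [hb, ← rpow_mul hCa.le, one_div_mul_cancel hp0.ne', rpow_one]
  have hbd : HasDerivAt (fun y => (C * a y) ^ (1 / p)) (b * (a' / (p * a x))) x := by
    refine ((ha.const_mul C).rpow_const (p := 1 / p) (Or.inl hCa.ne')).congr_deriv ?_
    rw [rpow_sub_one hCa.ne', ← hb]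
    field_simp
  set Y := b * u x with hY
  have hY0 : 0 < Y := by positivity
  have hYp : Y ^ (p - 1 - 1) = Y ^ p / (Y * Y) := by
    rw [rpow_sub_one hY0.ne', rpow_sub_one hY0.ne']; field_simp
  have hYp1 : Y ^ (p - 1) = Y ^ p / Y := rpow_sub_one hY0.ne' p
  have hYpp : 0 < Y ^ p := by positivity
  have hd := hw.div ((hbd.mul hu).rpow_const (p := p - 1) (Or.inl hY0.ne'))
    (by positivity : Y ^ (p - 1) ≠ 0)
  set ρ := w x / Y ^ (p - 1) with hρ
  have hρq : |ρ| ^ (p / (p - 1)) = |ε * d| ^ p / Y ^ p := by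
    rw [hρ, abs_div, hwx, div_rpow (abs_nonneg _) (abs_nonneg _), abs_phip_rpow hp,
      abs_of_pos (by positivity : 0 < Y ^ (p - 1)), ← rpow_mul hY0.le, mul_div_cancel₀ _ h2.ne']
  have hD := one_add_mul_abs_rpow_pos hp ρ
  set D := 1 + (p - 1) * |ρ| ^ (p / (p - 1)) with hDdef
  have hkey : (g * Y ^ (p - 1) - w x * ((b * (a' / (p * a x)) * u x + b * d) * (p - 1) *
      Y ^ (p - 1 - 1))) / (Y ^ (p - 1)) ^ 2 = -(b / ε) * D - (p - 1) * (a' / (p * a x)) * ρ := by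
    have hg : g = -(b * Y ^ (p - 1)) / ε := by
      rw [phip_of_pos hux, hbp] at heq
      have : b * Y ^ (p - 1) = b ^ p * u x ^ (p - 1) := by
        rw [hY, mul_rpow hb0.le hux.le, rpow_sub_one hb0.ne']; field_simp
      rw [this]; field_simp; linarith
    have hwd : w x * (ε * d) = |ε * d| ^ p := by rw [hwx, phip_mul_self hp]
    rw [hDdef, hρq, ← hwd, hρ, hg, hYp, hYp1]
    have hux' : u x = Y / b := by rw [hY]; field_simp
    rw [hux']
    field_simp
    ring
  have hk := (arcp_hasDerivAt hp ρ).comp x hd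
  refine ⟨_, hk, ?_⟩
  change |D⁻¹ * ((g * Y ^ (p - 1) - w x * ((b * (a' / (p * a x)) * u x + b * d) * (p - 1) *
      Y ^ (p - 1 - 1))) / (Y ^ (p - 1)) ^ 2) + b / ε| ≤ M
  rw [hkey]
  have hsimp : D⁻¹ * (-(b / ε) * D - (p - 1) * (a' / (p * a x)) * ρ) + b / ε =
      -((a' / a x) * ((p - 1) * ρ / (p * D))) := by field_simp; ring
  have hbound : |(p - 1) * ρ / (p * D)| ≤ 1 := by
    rw [abs_div, abs_mul, abs_of_pos h2, abs_of_pos (by positivity : 0 < p * D),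
      div_le_one (by positivity)]
    have hq1 : 1 ≤ p / (p - 1) := by rw [le_div_iff₀ h2]; linarith
    have hle : |ρ| ≤ 1 + |ρ| ^ (p / (p - 1)) := by
      rcases le_total |ρ| 1 with h | h
      · have : 0 ≤ |ρ| ^ (p / (p - 1)) := by positivity
        linarith
      · have := rpow_le_rpow_of_exponent_le h hq1
        rw [rpow_one] at this
        linarith
    have hnn : 0 ≤ |ρ| ^ (p / (p - 1)) := by positivity
    rw [hDdef]
    nlinarith [mul_nonneg h2.le hnn, mul_nonneg (mul_nonneg h2.le hnn) h2.le]
  have ha1 : |a' / a x| ≤ M := by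
    rw [abs_div, abs_of_pos hax, div_le_iff₀ hax]; exact hM
  rw [hsimp, abs_neg, abs_mul]
  calc _ ≤ M * 1 := mul_le_mul ha1 hbound (abs_nonneg _) ((abs_nonneg _).trans ha1)
    _ = M := mul_one M

section Gap

variable {p ε C M : ℝ} {a u u' : ℝ → ℝ} {s t α β : ℝ}

lemma continuous_const_mul_rpow (hp : 1 < p) (haC : ContDiff ℝ 1 a) :
    Continuous fun x => (C * a x) ^ (1 / p) :=
  (continuous_const.mul haC.continuous).rpow_const fun _ => Or.inr (by positivity)

lemma continuous_primitive_const_mul_rpow (hp : 1 < p) (haC : ContDiff ℝ 1 a) :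
    Continuous fun y => ∫ z in s..y, (C * a z) ^ (1 / p) :=
  intervalIntegral.continuous_primitive
    (fun _ _ => (continuous_const_mul_rpow hp haC).intervalIntegrable _ _) s

/-- On an interval where `u > 0` the Prüfer-type phase is almost affine. -/
lemma IsEigenSol.abs_phase_sub_le (h : IsEigenSol p ε C a u u' s t) (hp : 1 < p) (hε : 0 < ε)
    (hC : 0 < C) (haC : ContDiff ℝ 1 a) (hapos : ∀ x ∈ Icc s t, 0 < a x)
    (hM : ∀ x ∈ Icc s t, |deriv a x| ≤ M * a x) (hsα : s ≤ α) (hβt : β ≤ t)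
    (hpos : ∀ x ∈ Ioo α β, 0 < u x) {x y : ℝ} (hx : x ∈ Ioo α β) (hy : y ∈ Ioo α β) :
    |(arcp p (phip p (ε * u' y) / ((C * a y) ^ (1 / p) * u y) ^ (p - 1)) +
        (∫ z in s..y, (C * a z) ^ (1 / p)) / ε) -
      (arcp p (phip p (ε * u' x) / ((C * a x) ^ (1 / p) * u x) ^ (p - 1)) +
        (∫ z in s..x, (C * a z) ^ (1 / p)) / ε)| ≤ M * |y - x| := by
  obtain ⟨-, hu, g, -, hw, heq⟩ := h
  have hsub : ∀ z ∈ Ioo α β, z ∈ Icc s t ∧ Icc s t ∈ 𝓝 z := fun z hz =>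
    ⟨⟨hsα.trans hz.1.le, hz.2.le.trans hβt⟩,
      Icc_mem_nhds (hsα.trans_lt hz.1) (hz.2.trans_le hβt)⟩
  have hb := continuous_const_mul_rpow (C := C) hp haC
  have hder : ∀ z ∈ Ioo α β, ∃ k, HasDerivAt (fun y =>
      arcp p (phip p (ε * u' y) / ((C * a y) ^ (1 / p) * u y) ^ (p - 1)) +
        (∫ z in s..y, (C * a z) ^ (1 / p)) / ε) k z ∧ ‖k‖ ≤ M := by
    intro z hz
    obtain ⟨hz1, hz2⟩ := hsub z hz
    obtain ⟨k, hk, hkM⟩ := arcp_riccati (w := fun y => phip p (ε * u' y)) hp hε hC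
      (haC.differentiable one_ne_zero z).hasDerivAt (hapos z hz1) (hM z hz1)
      ((hu z hz1).hasDerivAt hz2) (hpos z hz) ((hw z hz1).hasDerivAt hz2) rfl (heq z hz1)
    exact ⟨_, hk.add ((hb.integral_hasStrictDerivAt s z).hasDerivAt.div_const ε), hkM⟩
  choose! k hk hkM using hder
  exact (convex_Ioo α β).norm_image_sub_le_of_norm_hasDerivWithin_le
    (fun z hz => (hk z hz).hasDerivWithinAt) hkM hx hy

lemma IsEigenSol.integral_le_of_pos (h : IsEigenSol p ε C a u u' s t) (hp : 1 < p) (hε : 0 < ε)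
    (hC : 0 < C) (haC : ContDiff ℝ 1 a) (hapos : ∀ x ∈ Icc s t, 0 < a x)
    (hM : ∀ x ∈ Icc s t, |deriv a x| ≤ M * a x) (hsα : s ≤ α) (hαβ : α < β) (hβt : β ≤ t)
    (hpos : ∀ x ∈ Ioo α β, 0 < u x) :
    (∫ z in s..β, (C * a z) ^ (1 / p)) - (∫ z in s..α, (C * a z) ^ (1 / p)) ≤
      ε * (pip p + M * (β - α)) := by
  have hB := continuous_primitive_const_mul_rpow (C := C) (s := s) hp haC
  set B : ℝ → ℝ := fun y => ∫ z in s..y, (C * a z) ^ (1 / p) with hBdef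
  have key : ∀ x ∈ Ioo α β, ∀ y ∈ Ioo x β, B y - B x ≤ ε * (pip p + M * (y - x)) := by
    intro x hx y hy
    have h1 := h.abs_phase_sub_le hp hε hC haC hapos hM hsα hβt hpos hx ⟨hx.1.trans hy.1, hy.2⟩
    rw [abs_of_pos (sub_pos.2 hy.1)] at h1
    have h1 := (le_abs_self _).trans h1
    have h2 := abs_le.1 (abs_arcp_le hp
      (phip p (ε * u' y) / ((C * a y) ^ (1 / p) * u y) ^ (p - 1)))
    have h3 := abs_le.1 (abs_arcp_le hp
      (phip p (ε * u' x) / ((C * a x) ^ (1 / p) * u x) ^ (p - 1)))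
    have h4 : (B y - B x) / ε ≤ pip p + M * (y - x) := by
      rw [sub_div]; linarith [h2.1, h3.2]
    rw [div_le_iff₀ hε] at h4
    linarith
  have key2 : ∀ x ∈ Ioo α β, B β - B x ≤ ε * (pip p + M * (β - x)) := by
    intro x hx
    refine ContinuousWithinAt.closure_le (s := Ioo x β) (f := fun y => B y - B x)
      (g := fun y => ε * (pip p + M * (y - x))) ?_ ?_ ?_ (key x hx)
    · rw [closure_Ioo hx.2.ne]; exact right_mem_Icc.2 hx.2.le
    · exact (hB.sub continuous_const).continuousWithinAt
    · exact (by fun_prop : Continuous fun y => ε * (pip p + M * (y - x))).continuousWithinAt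
  refine ContinuousWithinAt.closure_le (s := Ioo α β) (f := fun x => B β - B x)
      (g := fun x => ε * (pip p + M * (β - x))) ?_ ?_ ?_ key2
  · rw [closure_Ioo hαβ.ne]; exact left_mem_Icc.2 hαβ.le
  · exact (continuous_const.sub hB).continuousWithinAt
  · exact (by fun_prop : Continuous fun x => ε * (pip p + M * (β - x))).continuousWithinAt

lemma IsEigenSol.tendsto_denominator (h : IsEigenSol p ε C a u u' s t) (hp : 1 < p)
    (hC : 0 < C) (haC : ContDiff ℝ 1 a) (hapos : ∀ x ∈ Icc s t, 0 < a x)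
    (hsα : s ≤ α) (hβt : β ≤ t) (hpos : ∀ x ∈ Ioo α β, 0 < u x) {x : ℝ}
    (hx : x ∈ Icc s t) (hux : u x = 0) :
    Tendsto (fun y => ((C * a y) ^ (1 / p) * u y) ^ (p - 1)) (𝓝[Ioo α β] x) (𝓝[>] 0) := by
  have hsub : Ioo α β ⊆ Icc s t := fun z hz => ⟨hsα.trans hz.1.le, hz.2.le.trans hβt⟩
  have h2 : 0 < p - 1 := by linarith
  refine tendsto_nhdsWithin_iff.2 ⟨?_, ?_⟩
  · have hc : ContinuousWithinAt (fun y => ((C * a y) ^ (1 / p) * u y) ^ (p - 1)) (Ioo α β) x :=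
      ((continuous_const_mul_rpow hp haC).continuousWithinAt.mul
        ((h.continuousOn x hx).mono hsub)).rpow_const (Or.inr h2.le)
    simpa [ContinuousWithinAt, hux, zero_rpow h2.ne'] using hc
  · filter_upwards [self_mem_nhdsWithin] with y hy
    have := hapos y (hsub hy)
    have := hpos y hy
    exact mem_Ioi.2 (by positivity)

lemma IsEigenSol.tendsto_arcp_left (h : IsEigenSol p ε C a u u' s t) (hp : 1 < p) (hε : 0 < ε)
    (hC : 0 < C) (haC : ContDiff ℝ 1 a) (hapos : ∀ x ∈ Icc s t, 0 < a x)
    (hsα : s ≤ α) (hαβ : α < β) (hβt : β ≤ t)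
    (hpos : ∀ x ∈ Ioo α β, 0 < u x) (huα : u α = 0) (hu'α : u' α ≠ 0) :
    Tendsto (fun y => arcp p (phip p (ε * u' y) / ((C * a y) ^ (1 / p) * u y) ^ (p - 1)))
      (𝓝[Ioo α β] α) (𝓝 (pip p / 2)) := by
  have hsub : Ioo α β ⊆ Icc s t := fun z hz => ⟨hsα.trans hz.1.le, hz.2.le.trans hβt⟩
  have hα : α ∈ Icc s t := ⟨hsα, hαβ.le.trans hβt⟩
  have hne : (𝓝[Ioo α β] α).NeBot := left_nhdsWithin_Ioo_neBot hαβ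
  have hu'pos : 0 < u' α := by
    refine lt_of_le_of_ne ?_ hu'α.symm
    have hd := (hasDerivWithinAt_iff_tendsto_slope' (by simp)).1 ((h.2.1 α hα).mono hsub)
    refine ge_of_tendsto hd ?_
    filter_upwards [self_mem_nhdsWithin] with y hy
    rw [slope_def_field, huα, sub_zero]
    exact div_nonneg (hpos y hy).le (sub_nonneg.2 hy.1.le)
  have hw : Tendsto (fun y => phip p (ε * u' y)) (𝓝[Ioo α β] α) (𝓝 (phip p (ε * u' α))) :=
    ((phip_continuous hp).tendsto _).comp (((h.1 α hα).mono hsub).const_mul ε)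
  have hden := h.tendsto_denominator hp hC haC hapos hsα hβt hpos hα huα
  refine (arcp_tendsto_atTop hp).comp ?_
  simp only [div_eq_mul_inv]
  exact hw.pos_mul_atTop (phip_pos (by positivity)) (tendsto_inv_nhdsGT_zero.comp hden)

lemma IsEigenSol.tendsto_arcp_right (h : IsEigenSol p ε C a u u' s t) (hp : 1 < p) (hε : 0 < ε)
    (hC : 0 < C) (haC : ContDiff ℝ 1 a) (hapos : ∀ x ∈ Icc s t, 0 < a x)
    (hsα : s ≤ α) (hαβ : α < β) (hβt : β ≤ t)
    (hpos : ∀ x ∈ Ioo α β, 0 < u x) (huβ : u β = 0) (hu'β : u' β ≠ 0) :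
    Tendsto (fun y => arcp p (phip p (ε * u' y) / ((C * a y) ^ (1 / p) * u y) ^ (p - 1)))
      (𝓝[Ioo α β] β) (𝓝 (-(pip p / 2))) := by
  have hsub : Ioo α β ⊆ Icc s t := fun z hz => ⟨hsα.trans hz.1.le, hz.2.le.trans hβt⟩
  have hβ : β ∈ Icc s t := ⟨hsα.trans hαβ.le, hβt⟩
  have hne : (𝓝[Ioo α β] β).NeBot := right_nhdsWithin_Ioo_neBot hαβ
  have hu'neg : u' β < 0 := by
    refine lt_of_le_of_ne ?_ hu'β
    have hd := (hasDerivWithinAt_iff_tendsto_slope' (by simp)).1 ((h.2.1 β hβ).mono hsub)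
    refine le_of_tendsto hd ?_
    filter_upwards [self_mem_nhdsWithin] with y hy
    rw [slope_def_field, huβ, sub_zero]
    exact div_nonpos_of_nonneg_of_nonpos (hpos y hy).le (sub_nonpos.2 hy.2.le)
  have hw : Tendsto (fun y => phip p (ε * u' y)) (𝓝[Ioo α β] β) (𝓝 (phip p (ε * u' β))) :=
    ((phip_continuous hp).tendsto _).comp (((h.1 β hβ).mono hsub).const_mul ε)
  have hden := h.tendsto_denominator hp hC haC hapos hsα hβt hpos hβ huβ
  have hwneg : phip p (ε * u' β) < 0 := by
    have : 0 < phip p (ε * -u' β) := phip_pos (mul_pos hε (neg_pos.2 hu'neg))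
    rw [mul_neg, phip_neg] at this
    linarith
  refine (arcp_tendsto_atBot hp).comp ?_
  simp only [div_eq_mul_inv]
  exact hw.neg_mul_atTop hwneg (tendsto_inv_nhdsGT_zero.comp hden)

lemma IsEigenSol.abs_integral_sub_le_of_pos (h : IsEigenSol p ε C a u u' s t) (hp : 1 < p)
    (hε : 0 < ε) (hC : 0 < C) (haC : ContDiff ℝ 1 a) (hapos : ∀ x ∈ Icc s t, 0 < a x)
    (hM : ∀ x ∈ Icc s t, |deriv a x| ≤ M * a x) (hsα : s ≤ α) (hαβ : α < β) (hβt : β ≤ t)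
    (hpos : ∀ x ∈ Ioo α β, 0 < u x) (huα : u α = 0) (hu'α : u' α ≠ 0)
    (huβ : u β = 0) (hu'β : u' β ≠ 0) :
    |ε * pip p - ((∫ z in s..β, (C * a z) ^ (1 / p)) - ∫ z in s..α, (C * a z) ^ (1 / p))| ≤
      ε * M * (β - α) := by
  have hB := continuous_primitive_const_mul_rpow (C := C) (s := s) hp haC
  have hlip := fun x (hx : x ∈ Ioo α β) y (hy : y ∈ Ioo α β) =>
    h.abs_phase_sub_le hp hε hC haC hapos hM hsα hβt hpos hx hy
  have hne1 : (𝓝[Ioo α β] α).NeBot := left_nhdsWithin_Ioo_neBot hαβ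
  have hne2 : (𝓝[Ioo α β] β).NeBot := right_nhdsWithin_Ioo_neBot hαβ
  set B : ℝ → ℝ := fun y => ∫ z in s..y, (C * a z) ^ (1 / p) with hBdef
  have hl := (h.tendsto_arcp_left hp hε hC haC hapos hsα hαβ hβt hpos huα hu'α).add
    ((hB.tendsto α).mono_left (nhdsWithin_le_nhds (s := Ioo α β)) |>.div_const ε)
  have hr := (h.tendsto_arcp_right hp hε hC haC hapos hsα hαβ hβt hpos huβ hu'β).add
    ((hB.tendsto β).mono_left (nhdsWithin_le_nhds (s := Ioo α β)) |>.div_const ε)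
  have step : ∀ y ∈ Ioo α β, |(arcp p (phip p (ε * u' y) / ((C * a y) ^ (1 / p) * u y) ^ (p - 1)) +
      B y / ε) - (pip p / 2 + B α / ε)| ≤ M * |y - α| := by
    intro y hy
    refine le_of_tendsto_of_tendsto (hl.const_sub _).abs
      (((continuous_const.sub continuous_id).abs.const_mul M).continuousWithinAt
        (s := Ioo α β) (x := α)).tendsto ?_
    filter_upwards [self_mem_nhdsWithin] with x hx
    exact hlip x hx y hy
  have hfin : |(-(pip p / 2) + B β / ε) - (pip p / 2 + B α / ε)| ≤ M * |β - α| := by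
    refine le_of_tendsto_of_tendsto (hr.sub_const _).abs
      (((continuous_id.sub continuous_const).abs.const_mul M).continuousWithinAt
        (s := Ioo α β) (x := β)).tendsto ?_
    filter_upwards [self_mem_nhdsWithin] with y hy
    exact step y hy
  rw [abs_of_pos (sub_pos.2 hαβ)] at hfin
  have e : ε * pip p - (B β - B α) =
      -(ε * ((-(pip p / 2) + B β / ε) - (pip p / 2 + B α / ε))) := by field_simp; ring
  rw [e, abs_neg, abs_mul, abs_of_pos hε, mul_assoc]
  exact mul_le_mul_of_nonneg_left hfin hε.le

lemma forall_pos_or_forall_neg_of_ne_zero (hu : ContinuousOn u (Ioo α β))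
    (hne : ∀ x ∈ Ioo α β, u x ≠ 0) :
    (∀ x ∈ Ioo α β, 0 < u x) ∨ ∀ x ∈ Ioo α β, 0 < -u x := by
  by_contra! hcon
  obtain ⟨⟨x, hx, hux⟩, y, hy, huy⟩ := hcon
  obtain ⟨z, hz, hz0⟩ := isPreconnected_Ioo.intermediate_value hx hy hu
    (⟨hux, by linarith⟩ : (0:ℝ) ∈ Icc (u x) (u y))
  exact hne z hz hz0

lemma IsEigenSol.integral_le (h : IsEigenSol p ε C a u u' s t) (hp : 1 < p) (hε : 0 < ε)
    (hC : 0 < C) (haC : ContDiff ℝ 1 a) (hapos : ∀ x ∈ Icc s t, 0 < a x)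
    (hM : ∀ x ∈ Icc s t, |deriv a x| ≤ M * a x) (hsα : s ≤ α) (hαβ : α < β) (hβt : β ≤ t)
    (hne : ∀ x ∈ Ioo α β, u x ≠ 0) :
    (∫ z in s..β, (C * a z) ^ (1 / p)) - (∫ z in s..α, (C * a z) ^ (1 / p)) ≤
      ε * (pip p + M * (β - α)) := by
  have hsub : Ioo α β ⊆ Icc s t := fun z hz => ⟨hsα.trans hz.1.le, hz.2.le.trans hβt⟩
  rcases forall_pos_or_forall_neg_of_ne_zero (h.continuousOn.mono hsub) hne with hpos | hneg
  · exact h.integral_le_of_pos hp hε hC haC hapos hM hsα hαβ hβt hpos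
  · exact h.neg.integral_le_of_pos hp hε hC haC hapos hM hsα hαβ hβt hneg

/-- The distance between consecutive zeros, measured by `∫ (C a)^{1/p}`, is `ε π_p` up to a
relative error of order `ε`. -/
lemma IsEigenSol.abs_integral_sub_le (h : IsEigenSol p ε C a u u' s t) (hp : 1 < p)
    (hε : 0 < ε) (hC : 0 < C) (haC : ContDiff ℝ 1 a) (hapos : ∀ x ∈ Icc s t, 0 < a x)
    (hM : ∀ x ∈ Icc s t, |deriv a x| ≤ M * a x) (hsα : s ≤ α) (hαβ : α < β) (hβt : β ≤ t)
    (hne : ∀ x ∈ Ioo α β, u x ≠ 0) (huα : u α = 0) (hu'α : u' α ≠ 0)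
    (huβ : u β = 0) (hu'β : u' β ≠ 0) :
    |ε * pip p - ((∫ z in s..β, (C * a z) ^ (1 / p)) - ∫ z in s..α, (C * a z) ^ (1 / p))| ≤
      ε * M * (β - α) := by
  have hsub : Ioo α β ⊆ Icc s t := fun z hz => ⟨hsα.trans hz.1.le, hz.2.le.trans hβt⟩
  rcases forall_pos_or_forall_neg_of_ne_zero (h.continuousOn.mono hsub) hne with hpos | hneg
  · exact h.abs_integral_sub_le_of_pos hp hε hC haC hapos hM hsα hαβ hβt hpos huα hu'α huβ hu'β
  · exact h.neg.abs_integral_sub_le_of_pos hp hε hC haC hapos hM hsα hαβ hβt hneg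
      (neg_eq_zero.2 huα) (neg_ne_zero.2 hu'α) (neg_eq_zero.2 huβ) (neg_ne_zero.2 hu'β)

lemma IsEigenSol.finite_zeros (h : IsEigenSol p ε C a u u' s t)
    (hsimple : ∀ x ∈ Icc s t, u x = 0 → u' x ≠ 0) : {x ∈ Icc s t | u x = 0}.Finite := by
  have hcl : IsClosed {x ∈ Icc s t | u x = 0} :=
    h.continuousOn.preimage_isClosed_of_isClosed isClosed_Icc isClosed_singleton
  by_contra hinf
  obtain ⟨x, hx, hacc⟩ := Set.Infinite.exists_accPt_of_subset_isCompact hinf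
    (isCompact_Icc.of_isClosed_subset hcl fun y hy => hy.1) subset_rfl
  have hev := (h.2.1 x hx.1).eventually_ne (hsimple x hx.1 hx.2) (c := 0)
  rw [accPt_iff_frequently] at hacc
  rw [eventually_nhdsWithin_iff] at hev
  obtain ⟨y, ⟨hyx, hy⟩, hy2⟩ := (hacc.and_eventually hev).exists
  exact hy2 ⟨hy.1, hyx⟩ hy.2

lemma exists_last_zero_lt (hfin : {x ∈ Icc s t | u x = 0}.Finite) (hus : u s = 0) {x : ℝ}
    (hx : x ∈ Ioc s t) : ∃ z ∈ Ico s x, u z = 0 ∧ ∀ y ∈ Ioo z x, u y ≠ 0 := by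
  obtain ⟨z, hz, hmax⟩ := Set.exists_max_image {y ∈ Ico s x | u y = 0} id
    (hfin.subset fun y hy => ⟨⟨hy.1.1, hy.1.2.le.trans hx.2⟩, hy.2⟩)
    ⟨s, ⟨le_rfl, hx.1⟩, hus⟩
  refine ⟨z, hz.1, hz.2, fun y hy huy => ?_⟩
  exact (hmax y ⟨⟨hz.1.1.trans hy.1.le, hy.2⟩, huy⟩).not_gt hy.1

lemma IsEigenSol.abs_count_sub_integral_le (h : IsEigenSol p ε C a u u' s t) (hp : 1 < p)
    (hε : 0 < ε) (hC : 0 < C) (haC : ContDiff ℝ 1 a) (hapos : ∀ x ∈ Icc s t, 0 < a x)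
    (hM : ∀ x ∈ Icc s t, |deriv a x| ≤ M * a x) (hus : u s = 0)
    (hsimple : ∀ x ∈ Icc s t, u x = 0 → u' x ≠ 0) (n : ℕ) :
    ∀ x ∈ Icc s t, u x = 0 → {y ∈ Ioc s x | u y = 0}.ncard = n →
      |ε * pip p * n - ∫ z in s..x, (C * a z) ^ (1 / p)| ≤ ε * M * (x - s) := by
  have hfin := h.finite_zeros hsimple
  have hfin' : ∀ x ≤ t, {y ∈ Ioc s x | u y = 0}.Finite := fun x hx =>
    hfin.subset fun y hy => ⟨⟨hy.1.1.le, hy.1.2.trans hx⟩, hy.2⟩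
  induction n with
  | zero =>
    intro x hx hux hcard
    rw [Set.ncard_eq_zero (hfin' x hx.2)] at hcard
    have hxs : x = s := by
      by_contra hne
      have : x ∈ {y ∈ Ioc s x | u y = 0} := ⟨⟨lt_of_le_of_ne hx.1 (Ne.symm hne), le_rfl⟩, hux⟩
      rw [hcard] at this
      exact this
    simp [hxs]
  | succ n ih =>
    intro x hx hux hcard
    have hsx : s < x := by
      rcases hx.1.eq_or_lt with rfl | hlt
      · simp at hcard
      · exact hlt
    obtain ⟨z, hz, huz, hne⟩ := exists_last_zero_lt hfin hus ⟨hsx, hx.2⟩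
    have hzt : z ∈ Icc s t := ⟨hz.1, hz.2.le.trans hx.2⟩
    have hset : {y ∈ Ioc s x | u y = 0} = insert x {y ∈ Ioc s z | u y = 0} := by
      ext y
      constructor
      · rintro ⟨hy, huy⟩
        rcases hy.2.eq_or_lt with rfl | hyx
        · exact Set.mem_insert _ _
        · refine Set.mem_insert_of_mem _ ⟨⟨hy.1, ?_⟩, huy⟩
          by_contra! hzy
          exact hne y ⟨hzy, hyx⟩ huy
      · rintro (rfl | ⟨hy, huy⟩)
        · exact ⟨⟨hsx, le_rfl⟩, hux⟩
        · exact ⟨⟨hy.1, hy.2.trans hz.2.le⟩, huy⟩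
    rw [hset, Set.ncard_insert_of_notMem (fun hmem => hmem.1.2.not_gt hz.2) (hfin' z hzt.2)]
      at hcard
    have h1 := abs_le.1 (ih z hzt huz (by omega))
    have h2 := abs_le.1 (h.abs_integral_sub_le hp hε hC haC hapos hM hz.1 hz.2 hx.2 hne huz
      (hsimple z hzt huz) hux (hsimple x hx hux))
    push_cast
    rw [abs_le]
    constructor <;> nlinarith [h1.1, h1.2, h2.1, h2.2]

lemma IsEigenSol.abs_ncard_zeros_sub_integral_le (h : IsEigenSol p ε C a u u' s t) (hp : 1 < p)
    (hε : 0 < ε) (hC : 0 < C) (haC : ContDiff ℝ 1 a) (hapos : ∀ x ∈ Icc s t, 0 < a x)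
    (hM : ∀ x ∈ Icc s t, |deriv a x| ≤ M * a x) (hst : s < t) (hus : u s = 0) (hu's : u' s = 1) :
    |ε * pip p * {x ∈ Ioo s t | u x = 0}.ncard - ∫ z in s..t, (C * a z) ^ (1 / p)| ≤
      ε * (pip p + M * (t - s)) := by
  have hsimple : ∀ x ∈ Icc s t, u x = 0 → u' x ≠ 0 := fun x hx hux =>
    h.deriv_ne_zero hp hε hC haC hapos hM hu's hx hux
  obtain ⟨z, hz, huz, hne⟩ := exists_last_zero_lt (h.finite_zeros hsimple) hus ⟨hst, le_rfl⟩
  have hset : {x ∈ Ioo s t | u x = 0} = {y ∈ Ioc s z | u y = 0} := by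
    ext y
    constructor
    · rintro ⟨hy, huy⟩
      refine ⟨⟨hy.1, ?_⟩, huy⟩
      by_contra! hzy
      exact hne y ⟨hzy, hy.2⟩ huy
    · rintro ⟨hy, huy⟩
      exact ⟨⟨hy.1, hy.2.trans_lt hz.2⟩, huy⟩
  have h1 := abs_le.1 (h.abs_count_sub_integral_le hp hε hC haC hapos hM hus hsimple _ z
    ⟨hz.1, hz.2.le⟩ huz rfl)
  have h2 := h.integral_le hp hε hC haC hapos hM hz.1 hz.2 le_rfl hne
  have h3 : 0 ≤ ∫ x in z..t, (C * a x) ^ (1 / p) := by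
    refine intervalIntegral.integral_nonneg hz.2.le fun x hx => ?_
    have := hapos x ⟨hz.1.trans hx.1, hx.2⟩
    positivity
  have hb := continuous_const_mul_rpow (C := C) hp haC
  rw [← integral_interval_sub_left (hb.intervalIntegrable s t) (hb.intervalIntegrable s z)] at h3
  have hM0 : 0 ≤ M := by
    have hs := left_mem_Icc.2 hst.le
    exact nonneg_of_mul_nonneg_left ((abs_nonneg _).trans (hM s hs)) (hapos s hs)
  have hp1 := mul_pos hε (pip_pos hp)
  have hm1 : 0 ≤ ε * M * (t - z) := by
    have := sub_nonneg.2 hz.2.le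
    positivity
  rw [hset, abs_le]
  constructor <;> nlinarith [h1.1, h1.2]

end Gap

/-- Asymptotics of the number `l_ε(s,t)` of zeros in `(s,t)` of the
solution of `ε(φ_p(εu'))' + C₀ a(x)φ_p(u) = 0`, `u(s) = 0`, `u'(s) = 1`:
`ε l_ε(s,t) → (C₀^{1/p}/π_p) ∫_s^t a(x)^{1/p} dx` as `ε → 0⁺`. -/
theorem eigenvalue_count_asymptotics
    (p : ℝ) (hp : 1 < p)
    (a : ℝ → ℝ) (haC : ContDiff ℝ 1 a) (hapos : ∀ x ∈ Set.Icc (0:ℝ) 1, 0 < a x)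
    (C0 : ℝ) (hC0 : 0 < C0)
    (s t : ℝ) (hs : 0 ≤ s) (hst : s < t) (ht : t ≤ 1)
    (u u' : ℝ → ℝ → ℝ)
    (hsol : ∀ ε : ℝ, 0 < ε → IsEigenSol p ε C0 a (u ε) (u' ε) s t)
    (hinit : ∀ ε : ℝ, 0 < ε → u ε s = 0 ∧ u' ε s = 1) :
    Tendsto (fun ε : ℝ => ε * (Set.ncard {x ∈ Set.Ioo s t | u ε x = 0} : ℝ))
      (𝓝[>] (0:ℝ))
      (𝓝 (C0 ^ (1 / p) / pip p * ∫ x in s..t, a x ^ (1 / p))) := by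
  have hapos' : ∀ x ∈ Icc s t, 0 < a x := fun x hx =>
    hapos x ⟨hs.trans hx.1, hx.2.trans ht⟩
  obtain ⟨M, hM⟩ : ∃ M, ∀ x ∈ Icc s t, |deriv a x| ≤ M * a x := by
    have hc : ContinuousOn (fun x => deriv a x / a x) (Icc s t) :=
      (haC.continuous_deriv le_rfl).continuousOn.div haC.continuous.continuousOn
        fun x hx => (hapos' x hx).ne'
    obtain ⟨M, hM⟩ := isCompact_Icc.exists_bound_of_continuousOn hc
    refine ⟨M, fun x hx => ?_⟩
    have := hM x hx
    rwa [norm_eq_abs, abs_div, abs_of_pos (hapos' x hx), div_le_iff₀ (hapos' x hx)] at this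
  have hpip := pip_pos hp
  have hint : ∫ z in s..t, (C0 * a z) ^ (1 / p) = C0 ^ (1 / p) * ∫ x in s..t, a x ^ (1 / p) := by
    rw [← intervalIntegral.integral_const_mul]
    refine intervalIntegral.integral_congr fun x hx => ?_
    rw [uIcc_of_le hst.le] at hx
    exact mul_rpow hC0.le (hapos' x hx).le
  have hlim : Tendsto (fun ε : ℝ => ε * ((pip p + M * (t - s)) / pip p)) (𝓝[>] 0) (𝓝 0) := by
    have : Tendsto (fun ε : ℝ => ε * ((pip p + M * (t - s)) / pip p)) (𝓝 0)
        (𝓝 (0 * ((pip p + M * (t - s)) / pip p))) := tendsto_id.mul_const _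
    rw [zero_mul] at this
    exact this.mono_left nhdsWithin_le_nhds
  rw [tendsto_iff_dist_tendsto_zero]
  refine squeeze_zero' (Eventually.of_forall fun _ => dist_nonneg) ?_ hlim
  filter_upwards [self_mem_nhdsWithin] with ε hε
  have hε' : 0 < ε := hε
  have hmain := (hsol ε hε').abs_ncard_zeros_sub_integral_le hp hε' hC0 haC hapos' hM hst
    (hinit ε hε').1 (hinit ε hε').2
  rw [hint] at hmain
  rw [Real.dist_eq, ← mul_div_assoc, le_div_iff₀ hpip]
  refine le_trans (le_of_eq ?_) hmain
  rw [← abs_of_pos hpip, ← abs_mul, abs_of_pos hpip]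
  congr 1
  field_simp
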